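/- Let D = ker α∧β be an Engel structure and fix an (α,β)-adapted framing D = ⟨W, X⟩, giving the framing {W, X, T, R} of TM. Then c_WT = c_WR = c_XT = c_XR = 0 and d_WX = d_WT = 0. Moreover: b_WX = d_WR; b_XT = −a_WT; d_TR = L_W d_XR − L_X d_WR − a_WX·d_WR − d_XR·d_WR; c_TR = a_WR + b_XR; b_WR = −L_W d_TR + L_T d_WR + a_WT·d_WR + b_WT·d_XR; b_TR = −L_W c_TR + d_WR·c_TR; c_TR = −L_X d_TR + L_T d_XR − a_WT·d_XR + a_XT·d_WR − b_XR; and a_TR = L_X c_TR − d_XR·c_TR. -/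

import Mathlib

noncomputable section

open Manifold Module Function Set

variable {E : Type*} [NormedAddCommGroup E] [NormedSpace ℝ E]
  {H : Type*} [TopologicalSpace H]

/-- The type of (not necessarily smooth) vector fields on a manifold. -/
abbrev VF (I : ModelWithCorners ℝ E H) (M : Type*) [TopologicalSpace M] [ChartedSpace H M] :=
  ∀ x : M, TangentSpace I x

/-- A vector field is smooth if the corresponding section of the tangent bundle is smooth. -/
def SmoothVF (I : ModelWithCorners ℝ E H) {M : Type*} [TopologicalSpace M] [ChartedSpace H M]
    [IsManifold I (⊤ : ℕ∞) M] (V : VF I M) : Prop :=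
  ContMDiff I I.tangent (⊤ : ℕ∞) (fun x => (⟨x, V x⟩ : TangentBundle I M))

/-- A smooth real valued function on a manifold. -/
def SmoothFn (I : ModelWithCorners ℝ E H) {M : Type*} [TopologicalSpace M] [ChartedSpace H M]
    [IsManifold I (⊤ : ℕ∞) M] (f : M → ℝ) : Prop :=
  ContMDiff I 𝓘(ℝ) (⊤ : ℕ∞) f

/-- Derivative of a real valued function along a vector field. -/
def vderiv (I : ModelWithCorners ℝ E H) {M : Type*} [TopologicalSpace M] [ChartedSpace H M]
    [IsManifold I (⊤ : ℕ∞) M] (V : VF I M) (f : M → ℝ) : M → ℝ :=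
  fun x => mfderiv I 𝓘(ℝ) f x (V x)

/-- The Lie bracket of two vector fields on a manifold, defined by transporting the two
vector fields to the model space via the preferred chart at the given point, taking the
Lie bracket of vector fields there, and transporting the result back.  For smooth vector
fields this is the usual Lie bracket `[V, W]`. -/
def vfLie (I : ModelWithCorners ℝ E H) {M : Type*} [TopologicalSpace M] [ChartedSpace H M]
    [IsManifold I (⊤ : ℕ∞) M] (V W : VF I M) : VF I M := fun x₀ =>
  mfderiv 𝓘(ℝ, E) I (extChartAt I x₀).symm (extChartAt I x₀ x₀)
    ((VectorField.lieBracket ℝ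
      (fun e => (mfderiv I 𝓘(ℝ, E) (extChartAt I x₀) ((extChartAt I x₀).symm e)
        (V ((extChartAt I x₀).symm e)) : E))
      (fun e => (mfderiv I 𝓘(ℝ, E) (extChartAt I x₀) ((extChartAt I x₀).symm e)
        (W ((extChartAt I x₀).symm e)) : E))
      (extChartAt I x₀ x₀) : E))

/-- A smooth differential `1`-form on a manifold, given by its pointwise values. -/
structure OneForm (I : ModelWithCorners ℝ E H) (M : Type*) [TopologicalSpace M]
    [ChartedSpace H M] [IsManifold I (⊤ : ℕ∞) M] where
  val : ∀ x : M, TangentSpace I x →ₗ[ℝ] ℝ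
  smooth' : ∀ V : VF I M, SmoothVF I V → SmoothFn I (fun x => val x (V x))

/-- A smooth differential `k`-form on a manifold, given by its pointwise values. -/
structure FormPt (I : ModelWithCorners ℝ E H) (M : Type*) [TopologicalSpace M]
    [ChartedSpace H M] [IsManifold I (⊤ : ℕ∞) M] (k : ℕ) where
  val : ∀ x : M, (TangentSpace I x) [⋀^Fin k]→ₗ[ℝ] ℝ
  smooth' : ∀ V : Fin k → VF I M, (∀ i, SmoothVF I (V i)) →
    SmoothFn I (fun x => val x (fun i => V i x))

variable {I : ModelWithCorners ℝ E H} {M : Type*} [TopologicalSpace M] [ChartedSpace H M]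
  [IsManifold I (⊤ : ℕ∞) M]

/-- The exterior derivative of a (pointwise defined) `1`-form, evaluated on two vector
fields, via the Cartan formula `dω(V,W) = V (ω W) - W (ω V) - ω [V,W]`.  Here the `1`-form
is given as a function on vector fields. -/
def dOfFun (I : ModelWithCorners ℝ E H) {M : Type*} [TopologicalSpace M] [ChartedSpace H M]
    [IsManifold I (⊤ : ℕ∞) M] (lam : VF I M → M → ℝ) (V W : VF I M) : M → ℝ :=
  fun x => vderiv I V (lam W) x - vderiv I W (lam V) x - lam (vfLie I V W) x

/-- The exterior derivative of a `1`-form, as a function of two vector fields. -/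
def OneForm.d (ω : OneForm I M) (V W : VF I M) : M → ℝ :=
  dOfFun I (fun U x => ω.val x (U x)) V W

/-- A distribution (field of tangent subspaces) on a manifold. -/
abbrev TangentDist (I : ModelWithCorners ℝ E H) (M : Type*) [TopologicalSpace M] [ChartedSpace H M] :=
  ∀ x : M, Submodule ℝ (TangentSpace I x)

/-- A (smooth) section of a distribution. -/
def IsSection (I : ModelWithCorners ℝ E H) {M : Type*} [TopologicalSpace M] [ChartedSpace H M]
    [IsManifold I (⊤ : ℕ∞) M] (D : TangentDist I M) (V : VF I M) : Prop :=
  SmoothVF I V ∧ ∀ x, V x ∈ D x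

/-- The distribution `[D, D]` generated by a distribution `D` together with all Lie brackets
of its sections. -/
def derivedDist (I : ModelWithCorners ℝ E H) {M : Type*} [TopologicalSpace M] [ChartedSpace H M]
    [IsManifold I (⊤ : ℕ∞) M] (D : TangentDist I M) : TangentDist I M := fun x =>
  Submodule.span ℝ
    ({v | ∃ V, IsSection I D V ∧ V x = v} ∪
     {v | ∃ V W, IsSection I D V ∧ IsSection I D W ∧ vfLie I V W x = v})

/-- A distribution is integrable (in the sense of Frobenius: involutive) if Lie brackets of
its sections are again tangent to it. -/
def IsIntegrableDist (I : ModelWithCorners ℝ E H) {M : Type*} [TopologicalSpace M]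
    [ChartedSpace H M] [IsManifold I (⊤ : ℕ∞) M] (D : TangentDist I M) : Prop :=
  ∀ V W, IsSection I D V → IsSection I D W → ∀ x, vfLie I V W x ∈ D x

/-- `(ω ∧ θ)(U,V,W)` for a `1`-form `ω` and a `2`-form `θ` given as a function of two
vector fields. -/
def wedge1_2 (I : ModelWithCorners ℝ E H) {M : Type*} [TopologicalSpace M] [ChartedSpace H M]
    [IsManifold I (⊤ : ℕ∞) M] (ω : OneForm I M) (θ : VF I M → VF I M → M → ℝ)
    (U V W : VF I M) : M → ℝ := fun x =>
  ω.val x (U x) * θ V W x - ω.val x (V x) * θ U W x + ω.val x (W x) * θ U V x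

/-- The square `θ ∧ θ` of a `2`-form `θ` (given as a function of two vector fields) vanishes
identically. -/
def FormSqZero (I : ModelWithCorners ℝ E H) {M : Type*} [TopologicalSpace M] [ChartedSpace H M]
    [IsManifold I (⊤ : ℕ∞) M] (θ : VF I M → VF I M → M → ℝ) : Prop :=
  ∀ V₀ V₁ V₂ V₃ : VF I M, SmoothVF I V₀ → SmoothVF I V₁ → SmoothVF I V₂ → SmoothVF I V₃ →
    ∀ x, θ V₀ V₁ x * θ V₂ V₃ x - θ V₀ V₂ x * θ V₁ V₃ x + θ V₀ V₃ x * θ V₁ V₂ x = 0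

/-- An Engel structure: a rank 2 distribution `D` such that `E := [D,D]` has rank 3 and
`[E,E] = TM`. -/
def IsEngel (I : ModelWithCorners ℝ E H) {M : Type*} [TopologicalSpace M] [ChartedSpace H M]
    [IsManifold I (⊤ : ℕ∞) M] (D : TangentDist I M) : Prop :=
  (∀ x, Module.finrank ℝ (D x) = 2) ∧ (∀ x, Module.finrank ℝ (derivedDist I D x) = 3) ∧
  (∀ x, derivedDist I (derivedDist I D) x = ⊤)

/-- Engel defining forms: `D = ker α ∩ ker β` and `E = [D,D] = ker α`. -/
def EngelDefiningForms (I : ModelWithCorners ℝ E H) {M : Type*} [TopologicalSpace M]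
    [ChartedSpace H M] [IsManifold I (⊤ : ℕ∞) M] (D : TangentDist I M)
    (α β : OneForm I M) : Prop :=
  (∀ x, D x = LinearMap.ker (α.val x) ⊓ LinearMap.ker (β.val x)) ∧
  (∀ x, derivedDist I D x = LinearMap.ker (α.val x))

/-- The pair of Reeb vector fields `T`, `R` associated with Engel defining forms `α`, `β`:
`i_T(α ∧ dβ) = 0`, `β(T) = 1`, `α(T) = 0`, `i_R(β ∧ dβ) = 0`, `β(R) = 0`, `α(R) = 1`. -/
structure IsReebPair (I : ModelWithCorners ℝ E H) {M : Type*} [TopologicalSpace M]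
    [ChartedSpace H M] [IsManifold I (⊤ : ℕ∞) M] (α β : OneForm I M)
    (T R : VF I M) : Prop where
  smoothT : SmoothVF I T
  smoothR : SmoothVF I R
  alphaT : ∀ x, α.val x (T x) = 0
  betaT : ∀ x, β.val x (T x) = 1
  alphaR : ∀ x, α.val x (R x) = 1
  betaR : ∀ x, β.val x (R x) = 0
  insT : ∀ V W, SmoothVF I V → SmoothVF I W → ∀ x, wedge1_2 I α β.d T V W x = 0
  insR : ∀ V W, SmoothVF I V → SmoothVF I W → ∀ x, wedge1_2 I β β.d R V W x = 0

/-- The Reeb distribution spanned by the two Reeb vector fields. -/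
def reebDist (I : ModelWithCorners ℝ E H) {M : Type*} [TopologicalSpace M] [ChartedSpace H M]
    (T R : VF I M) : TangentDist I M := fun x => Submodule.span ℝ {T x, R x}

/-- `W` is a nonsingular vector field spanning the characteristic foliation of the even
contact structure `E = [D,D]`:  `W` is tangent to `D` and `[W, E] ⊆ E`. -/
def SpansChar (I : ModelWithCorners ℝ E H) {M : Type*} [TopologicalSpace M] [ChartedSpace H M]
    [IsManifold I (⊤ : ℕ∞) M] (D : TangentDist I M) (W : VF I M) : Prop :=
  SmoothVF I W ∧ (∀ x, W x ≠ 0) ∧ (∀ x, W x ∈ D x) ∧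
  ∀ V, IsSection I (derivedDist I D) V → ∀ x, vfLie I W V x ∈ derivedDist I D x

/-- A Riemannian metric, given by its pointwise values. -/
structure RMetric (I : ModelWithCorners ℝ E H) (M : Type*) [TopologicalSpace M]
    [ChartedSpace H M] [IsManifold I (⊤ : ℕ∞) M] where
  val : ∀ x : M, TangentSpace I x →ₗ[ℝ] TangentSpace I x →ₗ[ℝ] ℝ
  symm : ∀ x u v, val x u v = val x v u
  posdef : ∀ x v, v ≠ 0 → 0 < val x v v
  smooth' : ∀ V W, SmoothVF I V → SmoothVF I W → SmoothFn I (fun x => val x (V x) (W x))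

/-- The Koszul formula: `koszul g X Y Z = g(∇_X Y, Z)` where `∇` is the Levi-Civita
connection of `g`. -/
def koszul (I : ModelWithCorners ℝ E H) {M : Type*} [TopologicalSpace M] [ChartedSpace H M]
    [IsManifold I (⊤ : ℕ∞) M] (g : RMetric I M) (X Y Z : VF I M) : M → ℝ := fun x =>
  (vderiv I X (fun y => g.val y (Y y) (Z y)) x + vderiv I Y (fun y => g.val y (X y) (Z y)) x
    - vderiv I Z (fun y => g.val y (X y) (Y y)) x
    + g.val x (vfLie I X Y x) (Z x) - g.val x (vfLie I X Z x) (Y x)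
    - g.val x (vfLie I Y Z x) (X x)) / 2

/-- A distribution `D` is totally geodesic for `g` iff every geodesic tangent to it at one
point stays tangent to it; equivalently (the standard characterization, which we take as the
definition) `∇_U U` is tangent to `D` for every section `U` of `D`, i.e. `g(∇_U U, V) = 0`
for every vector field `V` orthogonal to `D`. -/
def IsTotallyGeodesic (I : ModelWithCorners ℝ E H) {M : Type*} [TopologicalSpace M]
    [ChartedSpace H M] [IsManifold I (⊤ : ℕ∞) M] (g : RMetric I M)
    (D : TangentDist I M) : Prop :=
  ∀ U, IsSection I D U → ∀ V, SmoothVF I V → (∀ x, ∀ u ∈ D x, g.val x (V x) u = 0) →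
    ∀ x, koszul I g U U V x = 0

/-- A Killing vector field: `L_Z g = 0`, expressed on vector fields. -/
def IsKilling (I : ModelWithCorners ℝ E H) {M : Type*} [TopologicalSpace M] [ChartedSpace H M]
    [IsManifold I (⊤ : ℕ∞) M] (g : RMetric I M) (Z : VF I M) : Prop :=
  ∀ V W, SmoothVF I V → SmoothVF I W → ∀ x,
    vderiv I Z (fun y => g.val y (V y) (W y)) x
      = g.val x (vfLie I Z V x) (W x) + g.val x (V x) (vfLie I Z W x)

/-- An Engel vector field: the flow of `Z` preserves `D`, i.e. `L_Z D ⊆ D`. -/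
def IsEngelVF (I : ModelWithCorners ℝ E H) {M : Type*} [TopologicalSpace M] [ChartedSpace H M]
    [IsManifold I (⊤ : ℕ∞) M] (D : TangentDist I M) (Z : VF I M) : Prop :=
  SmoothVF I Z ∧ ∀ V, IsSection I D V → ∀ x, vfLie I Z V x ∈ D x

/-- A K-Engel structure: `D` is an Engel structure, `g` a Riemannian metric and `Z` a
(nowhere vanishing) vector field which is Engel, Killing and orthogonal to `E = [D,D]`. -/
structure IsKEngel (I : ModelWithCorners ℝ E H) {M : Type*} [TopologicalSpace M]
    [ChartedSpace H M] [IsManifold I (⊤ : ℕ∞) M] (D : TangentDist I M)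
    (g : RMetric I M) (Z : VF I M) : Prop where
  engel : IsEngel I D
  engelVF : IsEngelVF I D Z
  killing : IsKilling I g Z
  orth : ∀ x, ∀ v ∈ derivedDist I D x, g.val x (Z x) v = 0
  nonzero : ∀ x, Z x ≠ 0

/-- A `1`-form is closed. -/
def OneForm.IsClosed {I : ModelWithCorners ℝ E H} {M : Type*} [TopologicalSpace M]
    [ChartedSpace H M] [IsManifold I (⊤ : ℕ∞) M] (ω : OneForm I M) : Prop :=
  ∀ V W, SmoothVF I V → SmoothVF I W → ∀ x, ω.d V W x = 0

/-- The Lie derivative `(L_Z ω)(V) = Z (ω V) - ω [Z,V]` of a `1`-form along a vector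
field, as a function of vector fields. -/
def lieOneForm (I : ModelWithCorners ℝ E H) {M : Type*} [TopologicalSpace M] [ChartedSpace H M]
    [IsManifold I (⊤ : ℕ∞) M] (ω : OneForm I M) (Z V : VF I M) : M → ℝ := fun x =>
  vderiv I Z (fun y => ω.val y (V y)) x - ω.val x (vfLie I Z V x)

/-- The exterior derivative of a pointwise-defined `(m+1)`-form evaluated on `m+2` vector
fields, via the global Koszul formula. -/
def extDerEval (I : ModelWithCorners ℝ E H) {M : Type*} [TopologicalSpace M] [ChartedSpace H M]
    [IsManifold I (⊤ : ℕ∞) M] {m : ℕ} (ν : FormPt I M (m+1)) (V : Fin (m+2) → VF I M) :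
    M → ℝ := fun x =>
  (∑ i : Fin (m+2), (-1 : ℝ)^(i : ℕ) *
    vderiv I (V i) (fun y => ν.val y (fun l => V (i.succAbove l) y)) x)
  + ∑ i : Fin (m+2), ∑ j : Fin (m+2), if h : (i : ℕ) < (j : ℕ) then
      (-1 : ℝ)^((i : ℕ)+(j : ℕ)) * ν.val x (Fin.cons (vfLie I (V i) (V j) x)
        (fun l => V (j.succAbove ((⟨(i : ℕ), by have := j.2; omega⟩ : Fin (m+1)).succAbove l)) x))
    else 0

/-- A pointwise-defined form is closed. -/
def FormPt.IsClosedForm {I : ModelWithCorners ℝ E H} {M : Type*} [TopologicalSpace M]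
    [ChartedSpace H M] [IsManifold I (⊤ : ℕ∞) M] {m : ℕ} (ν : FormPt I M (m+1)) : Prop :=
  ∀ V : Fin (m+2) → VF I M, (∀ i, SmoothVF I (V i)) → ∀ x, extDerEval I ν V x = 0

/-- `φ : ℝ → M → M` is the flow of the vector field `Z`. -/
def IsFlowOf (I : ModelWithCorners ℝ E H) {M : Type*} [TopologicalSpace M] [ChartedSpace H M]
    [IsManifold I (⊤ : ℕ∞) M] (Z : VF I M) (φ : ℝ → M → M) : Prop :=
  Continuous (fun p : ℝ × M => φ p.1 p.2) ∧ (∀ x, φ 0 x = x) ∧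
  (∀ s t x, φ (s + t) x = φ s (φ t x)) ∧
  ∀ x t, HasMFDerivAt 𝓘(ℝ) I (fun s => φ s x) t
    ((1 : ℝ →L[ℝ] ℝ).smulRight (Z (φ t x)))

/-- `(η ∧ dη ∧ dη)(V₀,...,V₄)` up to a positive constant factor, for a pointwise `1`-form
`η`; pointwise nonvanishing of this expression on frames is the contact condition in
dimension 5. -/
def contactEval (I : ModelWithCorners ℝ E H) {M : Type*} [TopologicalSpace M] [ChartedSpace H M]
    [IsManifold I (⊤ : ℕ∞) M] (η : ∀ z : M, TangentSpace I z →ₗ[ℝ] ℝ)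
    (V : Fin 5 → VF I M) : M → ℝ := fun z =>
  ∑ σ : Equiv.Perm (Fin 5), ((Equiv.Perm.sign σ : ℤ) : ℝ) *
    (η z (V (σ 0) z) * dOfFun I (fun U x => η x (U x)) (V (σ 1)) (V (σ 2)) z *
      dOfFun I (fun U x => η x (U x)) (V (σ 3)) (V (σ 4)) z)

open VectorField Filter Topology Bundle

lemma vfLie_eq_mlieBracket [I.Boundaryless] (V W : VF I M) :
    vfLie I V W = mlieBracket I V W := by
  have pull (U : VF I M) (x₀ : M) :
      (fun e => (mfderiv I 𝓘(ℝ, E) (extChartAt I x₀) ((extChartAt I x₀).symm e)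
        (U ((extChartAt I x₀).symm e)) : E)) =ᶠ[𝓝 (extChartAt I x₀ x₀)]
      mpullbackWithin 𝓘(ℝ, E) I (extChartAt I x₀).symm U (range I) := by
    filter_upwards [extChartAt_target_mem_nhds (I := I) x₀] with e he
    rw [mpullbackWithin_apply, ContinuousLinearMap.inverse_eq
      (mfderivWithin_extChartAt_symm_comp_mfderiv_extChartAt he)
      (mfderiv_extChartAt_comp_mfderivWithin_extChartAt_symm he)]
    rfl
  funext x₀
  have hbase : (mfderiv I 𝓘(ℝ, E) (extChartAt I x₀) x₀).inverse =
      mfderiv 𝓘(ℝ, E) I (extChartAt I x₀).symm (extChartAt I x₀ x₀) := by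
    have hr : range I = univ := I.range_eq_univ
    have h₁ := mfderivWithin_extChartAt_symm_comp_mfderiv_extChartAt' (I := I)
      (mem_extChartAt_source x₀)
    have h₂ := mfderiv_extChartAt_comp_mfderivWithin_extChartAt_symm' (I := I)
      (mem_extChartAt_source x₀)
    simp only [hr, mfderivWithin_univ] at h₁ h₂
    exact ContinuousLinearMap.inverse_eq h₂ h₁
  rw [← mlieBracketWithin_univ, mlieBracketWithin_apply, hbase]
  simp only [preimage_univ, univ_inter, I.range_eq_univ]
  have hV := pull V x₀
  have hW := pull W x₀
  rw [I.range_eq_univ] at hV hW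
  rw [vfLie, hV.lieBracket_vectorField_eq hW]
  exact congrArg _ (congrFun lieBracketWithin_univ.symm _)

lemma SmoothVF.mdifferentiableAt {V : VF I M} (hV : SmoothVF I V) (x : M) :
    MDiffAt (T% V) x :=
  ContMDiffAt.mdifferentiableAt (hV x) (by simp)

lemma SmoothVF.vfLie [I.Boundaryless] [CompleteSpace E] {V W : VF I M} (hV : SmoothVF I V)
    (hW : SmoothVF I W) : SmoothVF I (vfLie I V W) := by
  rw [vfLie_eq_mlieBracket]
  have : IsManifold I (((⊤ : ℕ∞) : WithTop ℕ∞) + 1) M := by simpa using ‹_›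
  have : IsManifold I (minSmoothness ℝ 2) M := IsManifold.of_le (n := ((⊤ : ℕ∞) : WithTop ℕ∞))
    (by simpa using WithTop.coe_le_coe.2 (le_top : (2 : ℕ∞) ≤ ⊤))
  intro x
  exact ContMDiffAt.mlieBracket_vectorField (m := ⊤) (n := ⊤) (hV x) (hW x) (by simp)

lemma vfLie_leibniz [I.Boundaryless] [CompleteSpace E] {U V W : VF I M} (hU : SmoothVF I U)
    (hV : SmoothVF I V) (hW : SmoothVF I W) (x : M) :
    vfLie I U (vfLie I V W) x = vfLie I (vfLie I U V) W x + vfLie I V (vfLie I U W) x := by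
  have hle : minSmoothness ℝ 3 ≤ ((⊤ : ℕ∞) : WithTop ℕ∞) := by
    simpa using WithTop.coe_le_coe.2 (le_top : (3 : ℕ∞) ≤ ⊤)
  have hle' : minSmoothness ℝ 2 ≤ ((⊤ : ℕ∞) : WithTop ℕ∞) := by
    simpa using WithTop.coe_le_coe.2 (le_top : (2 : ℕ∞) ≤ ⊤)
  have : IsManifold I (minSmoothness ℝ 3) M := IsManifold.of_le hle
  simp only [vfLie_eq_mlieBracket]
  exact leibniz_identity_mlieBracket_apply ((hU x).of_le hle') ((hV x).of_le hle')
    ((hW x).of_le hle')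

lemma vfLie_swap_apply [I.Boundaryless] (V W : VF I M) (x : M) :
    vfLie I V W x = -vfLie I W V x := by
  simp only [vfLie_eq_mlieBracket]
  exact mlieBracket_swap_apply

lemma vfLie_self [I.Boundaryless] (V : VF I M) (x : M) : vfLie I V V x = 0 := by
  simp [vfLie_eq_mlieBracket]

lemma vfLie_sum_smul [I.Boundaryless] [CompleteSpace E] {ι : Type*} (t : Finset ι) (V : VF I M)
    (f : ι → M → ℝ) (U : ι → VF I M) {x : M} (hf : ∀ i, MDiffAt (f i) x)
    (hU : ∀ i, MDiffAt (T% (U i)) x) :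
    vfLie I V (fun y => ∑ i ∈ t, f i y • U i y) x =
      ∑ i ∈ t, (vderiv I V (f i) x • U i x + f i x • vfLie I V (U i) x) := by
  classical
  simp only [vfLie_eq_mlieBracket]
  induction t using Finset.induction_on with
  | empty => exact congrFun (mlieBracket_zero_right (I := I) (W := V)) x
  | insert i t hi ih =>
    have hsum : MDiffAt (T% (fun y => ∑ i ∈ t, f i y • U i y)) x :=
      MDifferentiableAt.sum_section fun j _ => (hf j).smul_section (hU j)
    simp only [Finset.sum_insert hi, ← ih]
    have := mlieBracket_add_right (V := V) (W := f i • U i) ((hf i).smul_section (hU i)) hsum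
    rw [mlieBracket_smul_right (hf i) (hU i)] at this
    exact this

lemma mdifferentiableAt_frame_coeff {ι : Type} [Fintype ι] [FiniteDimensional ℝ E]
    (hcard : Fintype.card ι = finrank ℝ E) {s : ι → VF I M}
    (hli : ∀ y, LinearIndependent ℝ fun i => s i y) {f : ι → M → ℝ} {x : M}
    (hs : ∀ i, MDiffAt (T% (s i)) x) (hf : MDiffAt (T% (fun y => ∑ i, f i y • s i y)) x) (i : ι) :
    MDiffAt (f i) x := by
  classical
  let e := trivializationAt E (TangentSpace I) x
  let G : ι → M → (ι → ℝ) →L[ℝ] E := fun i y =>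
    (ContinuousLinearMap.proj i : (ι → ℝ) →L[ℝ] ℝ).smulRight (e (T% (s i) y)).2
  let F : M → (ι → ℝ) →L[ℝ] E := ∑ i, G i
  have hG (i : ι) : MDifferentiableAt I 𝓘(ℝ, (ι → ℝ) →L[ℝ] E) (G i) x :=
    (ContinuousLinearMap.smulRightL ℝ (ι → ℝ) E
      (ContinuousLinearMap.proj i)).differentiableAt.comp_mdifferentiableAt
        ((mdifferentiableAt_section I (s i)).1 (hs i))
  have hF : MDifferentiableAt I 𝓘(ℝ, (ι → ℝ) →L[ℝ] E) F x :=
    MDifferentiableAt.sum fun i _ => hG i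
  have hFapply (y : M) (hy : y ∈ e.baseSet) (c : ι → ℝ) :
      F y c = e.continuousLinearEquivAt ℝ y hy (∑ i, c i • s i y) := by
    simp [F, G]
  have hinv (y : M) (hy : y ∈ e.baseSet) : (F y).IsInvertible := by
    have hinj : Injective (F y : (ι → ℝ) →ₗ[ℝ] E) := by
      refine (injective_iff_map_eq_zero _).2 fun c hc => ?_
      rw [ContinuousLinearMap.coe_coe, hFapply y hy,
        ContinuousLinearEquiv.map_eq_zero_iff] at hc
      exact funext (Fintype.linearIndependent_iff.1 (hli y) c hc)
    exact ⟨(LinearEquiv.ofInjectiveOfFinrankEq _ hinj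
      (by simpa using hcard)).toContinuousLinearEquiv, rfl⟩
  have hx : x ∈ e.baseSet := mem_baseSet_trivializationAt E (TangentSpace I) x
  have hz := (mdifferentiableAt_section I (fun y => ∑ i, f i y • s i y)).1 hf
  have hinvF : MDifferentiableAt I 𝓘(ℝ, E →L[ℝ] ι → ℝ) (fun y => (F y).inverse) x :=
    (((hinv x hx).contDiffAt_map_inverse (n := 1)).differentiableAt
      one_ne_zero).comp_mdifferentiableAt hF
  have hcoeff : MDifferentiableAt I 𝓘(ℝ, ι → ℝ) (fun y j => f j y) x := by
    refine (hinvF.clm_apply hz).congr_of_eventuallyEq ?_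
    filter_upwards [e.open_baseSet.mem_nhds hx] with y hy
    refine ((hinv y hy).inverse_apply_eq.2 ?_).symm
    rw [hFapply y hy]
    rfl
  exact DifferentiableAt.comp_mdifferentiableAt (g := fun c : ι → ℝ => c i)
    (differentiable_apply i).differentiableAt hcoeff

lemma vderiv_const (V : VF I M) (c : ℝ) (x : M) : vderiv I V (fun _ => c) x = 0 := by
  rw [vderiv, mfderiv_const]
  rfl

lemma OneForm.d_apply_of_const (ω : OneForm I M) {V W : VF I M} {v w : ℝ}
    (hV : ∀ x, ω.val x (V x) = v) (hW : ∀ x, ω.val x (W x) = w) (x : M) :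
    ω.d V W x = -ω.val x (vfLie I V W x) := by
  simp only [OneForm.d, dOfFun, hV, hW, vderiv_const]
  ring

/-- In a smooth frame `{W, X, T, R}`, the value of a linear functional on `[V, Z]` in terms of the
components of `Z`. -/
lemma map_vfLie_frame [I.Boundaryless] [FiniteDimensional ℝ E] (hdim : finrank ℝ E = 4)
    {W X T R : VF I M} (hW : SmoothVF I W) (hX : SmoothVF I X) (hT : SmoothVF I T)
    (hR : SmoothVF I R) (hli : ∀ y, LinearIndependent ℝ ![W y, X y, T y, R y])
    {Z : VF I M} (hZ : SmoothVF I Z) {a b c d : M → ℝ}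
    (hZeq : ∀ y, Z y = a y • W y + b y • X y + c y • T y + d y • R y) (V : VF I M) (x : M)
    (l : TangentSpace I x →ₗ[ℝ] ℝ) :
    l (vfLie I V Z x) =
      (vderiv I V a x * l (W x) + a x * l (vfLie I V W x)) +
      (vderiv I V b x * l (X x) + b x * l (vfLie I V X x)) +
      (vderiv I V c x * l (T x) + c x * l (vfLie I V T x)) +
      (vderiv I V d x * l (R x) + d x * l (vfLie I V R x)) := by
  have : CompleteSpace E := FiniteDimensional.complete ℝ E
  let s : Fin 4 → VF I M := ![W, X, T, R]
  let f : Fin 4 → M → ℝ := ![a, b, c, d]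
  have hs (i : Fin 4) : MDiffAt (T% (s i)) x := by
    fin_cases i
    exacts [hW.mdifferentiableAt x, hX.mdifferentiableAt x, hT.mdifferentiableAt x,
      hR.mdifferentiableAt x]
  have hZs : Z = fun y => ∑ i, f i y • s i y := by
    funext y
    rw [hZeq y, Fin.sum_univ_four]
    rfl
  have hsli (y : M) : LinearIndependent ℝ fun i => s i y := by
    convert hli y using 1
    funext i
    fin_cases i <;> rfl
  have hZd := hZ.mdifferentiableAt x
  rw [hZs] at hZd
  have hf (i : Fin 4) : MDiffAt (f i) x :=
    mdifferentiableAt_frame_coeff (by simp [hdim]) hsli hs hZd i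
  rw [hZs, vfLie_sum_smul _ V f s hf hs]
  simp only [Fin.sum_univ_four, map_add, map_smul, smul_eq_mul]
  rfl

/-- Structure equations for the Lie brackets of an `(α,β)`-adapted framing
`{W, X, T, R}` of an Engel structure `D = ker α∧β`.  The coefficient functions
`a_AB, b_AB, c_AB, d_AB` are the `W`-, `X`-, `T`- and `R`-components of `[A,B]`. -/
theorem adapted_framing_structure_equations {M : Type*} [TopologicalSpace M]
    [ChartedSpace (EuclideanSpace ℝ (Fin 4)) M] [IsManifold (𝓡 4) (⊤ : ℕ∞) M]
    (D : TangentDist (𝓡 4) M) (α β : OneForm (𝓡 4) M)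
    (hD : IsEngel (𝓡 4) D) (hforms : EngelDefiningForms (𝓡 4) D α β)
    (T R : VF (𝓡 4) M) (hTR : IsReebPair (𝓡 4) α β T R)
    (W X : VF (𝓡 4) M) (hWchar : SpansChar (𝓡 4) D W) (hXs : SmoothVF (𝓡 4) X)
    (hspan : ∀ x, D x = Submodule.span ℝ {W x, X x})
    (hbasis : ∀ x, LinearIndependent ℝ ![W x, X x, T x, R x])
    -- components of the Lie brackets with respect to the framing `{W, X, T, R}`
    (aWX bWX cWX dWX aWT bWT cWT dWT aWR bWR cWR dWR : M → ℝ)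
    (aXT bXT cXT dXT aXR bXR cXR dXR aTR bTR cTR dTR : M → ℝ)
    (hWX : ∀ x, vfLie (𝓡 4) W X x
      = aWX x • W x + bWX x • X x + cWX x • T x + dWX x • R x)
    (hWT : ∀ x, vfLie (𝓡 4) W T x
      = aWT x • W x + bWT x • X x + cWT x • T x + dWT x • R x)
    (hWR : ∀ x, vfLie (𝓡 4) W R x
      = aWR x • W x + bWR x • X x + cWR x • T x + dWR x • R x)
    (hXT : ∀ x, vfLie (𝓡 4) X T x
      = aXT x • W x + bXT x • X x + cXT x • T x + dXT x • R x)
    (hXR : ∀ x, vfLie (𝓡 4) X R x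
      = aXR x • W x + bXR x • X x + cXR x • T x + dXR x • R x)
    (hTR' : ∀ x, vfLie (𝓡 4) T R x
      = aTR x • W x + bTR x • X x + cTR x • T x + dTR x • R x)
    -- the framing is `(α,β)`-adapted: `c_WX = 1` and `d_XT = 1`
    (hadapted₁ : ∀ x, cWX x = 1) (hadapted₂ : ∀ x, dXT x = 1) :
    (∀ x, cWT x = 0) ∧ (∀ x, cWR x = 0) ∧ (∀ x, cXT x = 0) ∧ (∀ x, cXR x = 0) ∧
    (∀ x, dWX x = 0) ∧ (∀ x, dWT x = 0) ∧
    (∀ x, bWX x = dWR x) ∧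
    (∀ x, bXT x = -aWT x) ∧
    (∀ x, dTR x = vderiv (𝓡 4) W dXR x - vderiv (𝓡 4) X dWR x
      - aWX x * dWR x - dXR x * dWR x) ∧
    (∀ x, cTR x = aWR x + bXR x) ∧
    (∀ x, bWR x = -vderiv (𝓡 4) W dTR x + vderiv (𝓡 4) T dWR x
      + aWT x * dWR x + bWT x * dXR x) ∧
    (∀ x, bTR x = -vderiv (𝓡 4) W cTR x + dWR x * cTR x) ∧
    (∀ x, cTR x = -vderiv (𝓡 4) X dTR x + vderiv (𝓡 4) T dXR x
      - aWT x * dXR x + aXT x * dWR x - bXR x) ∧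
    (∀ x, aTR x = vderiv (𝓡 4) X cTR x - dXR x * cTR x) := by
  obtain ⟨hW, -, hWD, hWE⟩ := hWchar
  have hT := hTR.smoothT
  have hR := hTR.smoothR
  have hXD (x : M) : X x ∈ D x := by
    rw [hspan x]
    exact Submodule.subset_span (by simp)
  have hαβ {V : VF (𝓡 4) M} (hV : ∀ x, V x ∈ D x) (x : M) :
      α.val x (V x) = 0 ∧ β.val x (V x) = 0 := by
    simpa [hforms.1 x] using hV x
  have αW (x : M) := (hαβ hWD x).1
  have βW (x : M) := (hαβ hWD x).2
  have αX (x : M) := (hαβ hXD x).1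
  have βX (x : M) := (hαβ hXD x).2
  have αT := hTR.alphaT
  have βT := hTR.betaT
  have αR := hTR.alphaR
  have βR := hTR.betaR
  -- the `α`- and `β`-values of a combination of the frame are its `R`- and `T`-components
  have αcomb (x : M) (a b c d : ℝ) :
      α.val x (a • W x + b • X x + c • T x + d • R x) = d := by
    simp [αW, αX, αT, αR]
  have βcomb (x : M) (a b c d : ℝ) :
      β.val x (a • W x + b • X x + c • T x + d • R x) = c := by
    simp [βW, βX, βT, βR]
  have hdβT {V : VF (𝓡 4) M} (hV : SmoothVF (𝓡 4) V) (αV : ∀ x, α.val x (V x) = 0)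
      (βV : ∀ x, β.val x (V x) = 0) (x : M) : β.val x (vfLie (𝓡 4) V T x) = 0 := by
    have h := hTR.insT V R hV hR x
    simp only [wedge1_2, αT, αR, αV, β.d_apply_of_const βT βV] at h
    rw [vfLie_swap_apply, map_neg]
    linarith
  have hdβR {V : VF (𝓡 4) M} (hV : SmoothVF (𝓡 4) V)
      (βV : ∀ x, β.val x (V x) = 0) (x : M) : β.val x (vfLie (𝓡 4) V R x) = 0 := by
    have h := hTR.insR V T hV hT x
    simp only [wedge1_2, βT, βR, βV, β.d_apply_of_const βR βV] at h
    rw [vfLie_swap_apply, map_neg]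
    linarith
  have hE {V : VF (𝓡 4) M} (hV : SmoothVF (𝓡 4) V) (αV : ∀ x, α.val x (V x) = 0) (x : M) :
      α.val x (vfLie (𝓡 4) W V x) = 0 := by
    have h := hWE V ⟨hV, fun y => by simp [hforms.2 y, αV y]⟩ x
    simpa [hforms.2 x] using h
  obtain rfl : cWX = fun _ => 1 := funext hadapted₁
  obtain rfl : dXT = fun _ => 1 := funext hadapted₂
  obtain rfl : cWT = fun _ => 0 := funext fun x => by
    rw [← hdβT hW αW βW x, hWT, βcomb]
  obtain rfl : cWR = fun _ => 0 := funext fun x => by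
    rw [← hdβR hW βW x, hWR, βcomb]
  obtain rfl : cXT = fun _ => 0 := funext fun x => by
    rw [← hdβT hXs αX βX x, hXT, βcomb]
  obtain rfl : cXR = fun _ => 0 := funext fun x => by
    rw [← hdβR hXs βX x, hXR, βcomb]
  obtain rfl : dWX = fun _ => 0 := funext fun x => by
    rw [← hE hXs αX x, hWX, αcomb]
  obtain rfl : dWT = fun _ => 0 := funext fun x => by
    rw [← hE hT αT x, hWT, αcomb]
  have expand {Z : VF (𝓡 4) M} (hZ : SmoothVF (𝓡 4) Z) {a b c d : M → ℝ}
      (hZeq : ∀ y, Z y = a y • W y + b y • X y + c y • T y + d y • R y) (V : VF (𝓡 4) M) (x : M)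
      (l : TangentSpace (𝓡 4) x →ₗ[ℝ] ℝ) :=
    map_vfLie_frame (by simp) hW hXs hT hR hbasis hZ hZeq V x l
  have jacobi {A B C : VF (𝓡 4) M} (hA : SmoothVF (𝓡 4) A) (hB : SmoothVF (𝓡 4) B)
      (hC : SmoothVF (𝓡 4) C) (x : M) (l : TangentSpace (𝓡 4) x →ₗ[ℝ] ℝ) :
      l (vfLie (𝓡 4) A (vfLie (𝓡 4) B C) x) =
        -l (vfLie (𝓡 4) C (vfLie (𝓡 4) A B) x) + l (vfLie (𝓡 4) B (vfLie (𝓡 4) A C) x) := by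
    rw [vfLie_leibniz hA hB hC, map_add, vfLie_swap_apply (vfLie (𝓡 4) A B), map_neg]
  have eWX := expand (hW.vfLie hXs) hWX
  have eWT := expand (hW.vfLie hT) hWT
  have eWR := expand (hW.vfLie hR) hWR
  have eXT := expand (hXs.vfLie hT) hXT
  have eXR := expand (hXs.vfLie hR) hXR
  have eTR := expand (hT.vfLie hR) hTR'
  have sXW := vfLie_swap_apply X W
  have sTW := vfLie_swap_apply T W
  have sTX := vfLie_swap_apply T X
  have sRW := vfLie_swap_apply R W
  have sRX := vfLie_swap_apply R X
  have sRT := vfLie_swap_apply R T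
  have αWXT (x : M) := jacobi hW hXs hT x (α.val x)
  have βWXT (x : M) := jacobi hW hXs hT x (β.val x)
  have αWXR (x : M) := jacobi hW hXs hR x (α.val x)
  have βWXR (x : M) := jacobi hW hXs hR x (β.val x)
  have αWTR (x : M) := jacobi hW hT hR x (α.val x)
  have βWTR (x : M) := jacobi hW hT hR x (β.val x)
  have αXTR (x : M) := jacobi hXs hT hR x (α.val x)
  have βXTR (x : M) := jacobi hXs hT hR x (β.val x)
  simp only [eWX, eWT, eWR, eXT, eXR, eTR, sXW, sTW, sTX, sRW, sRX, sRT, vfLie_self, hWX, hWT,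
    hWR, hXT, hXR, hTR', αcomb, βcomb, αW, αX, αT, αR, βW, βX, βT, βR, vderiv_const, map_neg,
    map_zero] at αWXT βWXT αWXR βWXR αWTR βWTR αXTR βXTR
  have hbWX (x : M) : bWX x = dWR x := by linarith [αWXT x]
  have hbXT (x : M) : bXT x = -aWT x := by linarith [βWXT x]
  simp only [hbWX, hbXT] at αWXR αXTR
  refine ⟨fun _ => rfl, fun _ => rfl, fun _ => rfl, fun _ => rfl, fun _ => rfl, fun _ => rfl,
    hbWX, hbXT, fun x => ?_, fun x => ?_, fun x => ?_, fun x => ?_, fun x => ?_, fun x => ?_⟩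
  · linarith [αWXR x]
  · linarith [βWXR x]
  · linarith [αWTR x]
  · linarith [βWTR x]
  · linarith [αXTR x]
  · linarith [βXTR x]

end
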